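/- If a Markov kernel K on a measurable space leaves a probability measure π invariant, is π-irreducible and aperiodic, then for π-almost every starting point x the iterates K^r(x, ·) converge to π in total variation norm as r → ∞. -/

import Mathlib

open MeasureTheory ProbabilityTheory Filter

/-- The `r`-fold iterate `K^r` of a Markov kernel:
`K^0 = id` and `K^{r+1}(x, A) = ∫ K^r(y, A) K(x, dy)`. -/
noncomputable def kiter {X : Type*} [MeasurableSpace X] (K : Kernel X X) : ℕ → Kernel X X
  | 0 => Kernel.id
  | r + 1 => (kiter K r).comp K

/-- Total variation distance between two measures, as the supremum over measurable sets
of the absolute difference of their (real-valued) masses. -/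
noncomputable def tvDist {X : Type*} [MeasurableSpace X] (μ ν : Measure X) : ℝ :=
  ⨆ A : { A : Set X // MeasurableSet A }, |(μ A.1).toReal - (ν A.1).toReal|

open scoped Topology ENNReal

theorem kiter_eq_pow {X : Type*} [MeasurableSpace X] (K : Kernel X X) (n : ℕ) :
    kiter K n = K ^ n := by
  induction n with
  | zero => rfl
  | succ n ih => rw [kiter, ih, pow_succ]; rfl

theorem invariant_pow {X : Type*} [MeasurableSpace X] {K : Kernel X X} {π : Measure X}
    (hK : K.Invariant π) (n : ℕ) : (K ^ n).Invariant π := by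
  induction n with
  | zero => exact Measure.id_comp
  | succ n ih => rw [Kernel.pow_add, pow_one]; exact ih.comp hK

section Markov

variable {X : Type*} [MeasurableSpace X] {K : Kernel X X} [IsMarkovKernel K]

instance isMarkovKernel_pow (n : ℕ) : IsMarkovKernel (K ^ n) := by
  induction n with
  | zero => exact inferInstanceAs (IsMarkovKernel (Kernel.id : Kernel X X))
  | succ n ih => rw [Kernel.pow_add, pow_one]; infer_instance

/-- A bounded measurable function, with bound `1`. -/
structure UnitBounded (h : X → ℝ) : Prop where
  measurable : Measurable h
  abs_le_one : ∀ x, |h x| ≤ 1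

theorem integrable_of_abs_le {μ : Measure X} [IsFiniteMeasure μ] {h : X → ℝ} {C : ℝ}
    (hm : Measurable h) (hb : ∀ x, |h x| ≤ C) : Integrable h μ :=
  Integrable.of_bound hm.aestronglyMeasurable C (ae_of_all _ hb)

theorem UnitBounded.integrable {μ : Measure X} [IsFiniteMeasure μ] {h : X → ℝ}
    (hh : UnitBounded h) : Integrable h μ :=
  integrable_of_abs_le hh.measurable hh.abs_le_one

theorem UnitBounded.sq {h : X → ℝ} (hh : UnitBounded h) : UnitBounded (fun x => h x ^ 2) where
  measurable := hh.measurable.pow_const 2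
  abs_le_one x := by
    rw [abs_pow]
    exact pow_le_one₀ (abs_nonneg _) (hh.abs_le_one x)

/-- The action of the `n`-th power of a kernel on functions. -/
noncomputable def expect (K : Kernel X X) (n : ℕ) (h : X → ℝ) (x : X) : ℝ :=
  ∫ y, h y ∂(K ^ n) x

theorem UnitBounded.expect {h : X → ℝ} (hh : UnitBounded h) (n : ℕ) :
    UnitBounded (expect K n h) where
  measurable := (hh.measurable.stronglyMeasurable.integral_kernel (κ := K ^ n)).measurable
  abs_le_one x := by
    have := norm_integral_le_of_norm_le_const (μ := (K ^ n) x) (f := h) (C := 1)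
      (ae_of_all _ hh.abs_le_one)
    simpa [_root_.expect] using this

theorem expect_add {h : X → ℝ} (hh : UnitBounded h) (m n : ℕ) :
    expect K (m + n) h = expect K m (expect K n h) := by
  ext x
  rw [expect, add_comm, Kernel.pow_add, Kernel.integral_comp hh.integrable]
  rfl

theorem expect_zero {K : Kernel X X} {h : X → ℝ} (hh : UnitBounded h) : expect K 0 h = h := by
  ext x
  rw [expect, pow_zero]
  exact integral_dirac' h x hh.measurable.stronglyMeasurable

variable {π : Measure X} [IsProbabilityMeasure π]

theorem integral_expect (hK : K.Invariant π) {h : X → ℝ} (hh : UnitBounded h) (n : ℕ) :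
    ∫ x, expect K n h x ∂π = ∫ x, h x ∂π := by
  have hK' : (K ^ n) ∘ₘ π = π := invariant_pow hK n
  conv_rhs => rw [← hK', Measure.comp_eq_comp_const_apply]
  rw [Kernel.integral_comp hh.integrable]
  rfl

theorem integral_sq_sub_expect (hK : K.Invariant π) {h : X → ℝ} (hh : UnitBounded h) (n : ℕ) :
    ∫ z, (h z.2 - expect K n h z.1) ^ 2 ∂(π ⊗ₘ (K ^ n)) =
      ∫ x, h x ^ 2 ∂π - ∫ x, expect K n h x ^ 2 ∂π := by
  have hg := hh.expect (K := K) n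
  rw [Measure.integral_compProd]
  · have key : ∀ x, ∫ y, (h y - expect K n h x) ^ 2 ∂(K ^ n) x =
        expect K n (fun y => h y ^ 2) x - expect K n h x ^ 2 := by
      intro x
      have e : ∀ y, (h y - expect K n h x) ^ 2 =
          h y ^ 2 - 2 * expect K n h x * h y + expect K n h x ^ 2 := fun y => by ring
      simp_rw [e]
      rw [integral_add, integral_sub, integral_const_mul]
      · simp only [expect, integral_const, probReal_univ, smul_eq_mul]
        ring
      · exact hh.sq.integrable
      · exact hh.integrable.const_mul _
      · exact hh.sq.integrable.sub (hh.integrable.const_mul _)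
      · exact integrable_const _
    simp_rw [key]
    rw [integral_sub (hh.sq.expect n).integrable hg.sq.integrable, integral_expect hK hh.sq]
  · refine integrable_of_abs_le (C := 4) ?_ fun z => ?_
    · exact ((hh.measurable.comp measurable_snd).sub (hg.measurable.comp measurable_fst)).pow_const
        2
    · rw [abs_of_nonneg (sq_nonneg _)]
      have h1 := abs_le.1 (hh.abs_le_one z.2)
      have h2 := abs_le.1 (hg.abs_le_one z.1)
      nlinarith

theorem integral_sq_expect_antitone (hK : K.Invariant π) {h : X → ℝ} (hh : UnitBounded h) :
    Antitone fun n => ∫ x, expect K n h x ^ 2 ∂π := by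
  refine antitone_nat_of_succ_le fun n => ?_
  have := integral_sq_sub_expect hK (hh.expect (K := K) n) 1
  rw [← expect_add hh, add_comm 1 n] at this
  have h0 : 0 ≤ ∫ z, (expect K n h z.2 - expect K (n + 1) h z.1) ^ 2 ∂(π ⊗ₘ (K ^ 1)) :=
    integral_nonneg fun z => sq_nonneg _
  linarith

theorem integral_sq_le_one {h : X → ℝ} (hh : UnitBounded h) : ∫ x, h x ^ 2 ∂π ≤ 1 := by
  have := integral_mono (μ := π) hh.sq.integrable (integrable_const (1 : ℝ))
    fun x => (abs_le.1 (hh.sq.abs_le_one x)).2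
  simpa using this

theorem exists_absorbing_subset {K : Kernel X X} {π : Measure X} (hK : K.Invariant π) {S : Set X}
    (hS : MeasurableSet S) (hπ : ∀ᵐ x ∂π, x ∈ S) :
    ∃ G ⊆ S, MeasurableSet G ∧ (∀ᵐ x ∂π, x ∈ G) ∧ ∀ x ∈ G, ∀ᵐ y ∂K x, y ∈ G := by
  let G : ℕ → Set X := fun j => Nat.rec S (fun _ A => A ∩ {x | K x Aᶜ = 0}) j
  have hG : ∀ j, MeasurableSet (G j) ∧ ∀ᵐ x ∂π, x ∈ G j := by
    intro j
    induction j with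
    | zero => exact ⟨hS, hπ⟩
    | succ j ih =>
      refine ⟨ih.1.inter (K.measurable_coe ih.1.compl (measurableSet_singleton 0)), ?_⟩
      have h : ∀ᵐ x ∂(K ∘ₘ π), x ∈ G j := by
        rw [hK.def]
        exact ih.2
      filter_upwards [ih.2, Measure.ae_ae_of_ae_comp h] with x hx hx'
      exact ⟨hx, hx'⟩
  refine ⟨⋂ j, G j, Set.iInter_subset G 0, .iInter fun j => (hG j).1,
    ?_, fun x hx => ?_⟩
  · simpa only [Set.mem_iInter] using ae_all_iff.2 fun j => (hG j).2
  · simp only [Set.mem_iInter] at hx ⊢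
    exact ae_all_iff.2 fun j => (hx (j + 1)).2

/-- The shifts `m` for which the sequence at `y`, moved by `m`, is asymptotic to the one at `x`. -/
def asympShift (u : ℕ → ℤ → X → ℝ) (x y : X) : Set ℤ :=
  {m | ∀ k, Tendsto (fun N => u N (k + m) y - u N k x) atTop (𝓝 0)}

theorem add_mem_asympShift {X : Type*} {u : ℕ → ℤ → X → ℝ} {x y z : X} {m n : ℤ}
    (hm : m ∈ asympShift u x y) (hn : n ∈ asympShift u y z) : m + n ∈ asympShift u x z := by
  intro k
  have := (hm k).add (hn (k + m))
  simpa [add_assoc] using this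

theorem neg_mem_asympShift {X : Type*} {u : ℕ → ℤ → X → ℝ} {x y : X} {m : ℤ}
    (hm : m ∈ asympShift u x y) : -m ∈ asympShift u y x := by
  intro k
  simpa using (hm (k + -m)).neg

/-- The group of asymptotic periods at `x`. -/
def asympPeriod {X : Type*} (u : ℕ → ℤ → X → ℝ) (x : X) : AddSubgroup ℤ where
  carrier := asympShift u x x
  zero_mem' k := by simp
  add_mem' := add_mem_asympShift
  neg_mem' := neg_mem_asympShift

theorem measurableSet_mem_asympShift {u : ℕ → ℤ → X → ℝ} (hu : ∀ N k, Measurable (u N k))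
    (x : X) (m : ℤ) : MeasurableSet {y | m ∈ asympShift u x y} := by
  have h : {y | m ∈ asympShift u x y} =
      ⋂ k, {y | Tendsto (fun N => u N (k + m) y - u N k x) atTop (𝓝 0)} := by
    ext y
    simp [asympShift]
  rw [h]
  exact .iInter fun k => measurableSet_tendsto (𝓝 0) fun N => (hu N _).sub_const _

theorem exists_two_le_forall_dvd {H : AddSubgroup ℤ} (hH : (1 : ℤ) ∉ H) :
    ∃ p : ℕ, 2 ≤ p ∧ ∀ m ∈ H, (p : ℤ) ∣ m := by
  obtain ⟨a, rfl⟩ := Int.subgroup_cyclic H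
  simp only [AddSubgroup.mem_closure_singleton, smul_eq_mul] at hH ⊢
  rcases eq_or_ne a 0 with rfl | ha
  · exact ⟨2, le_rfl, by rintro m ⟨n, rfl⟩; simp⟩
  · refine ⟨a.natAbs, ?_, ?_⟩
    · by_contra! h
      have : a = 1 ∨ a = -1 := by omega
      rcases this with rfl | rfl
      · exact hH ⟨1, by norm_num⟩
      · exact hH ⟨-1, by norm_num⟩
    · rintro m ⟨n, rfl⟩
      exact Int.natAbs_dvd.2 (dvd_mul_left a n)

theorem Fin.val_add_one_mod_lt {p : ℕ} (i : Fin p) : (i.val + 1) % p < p :=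
  Nat.mod_lt _ i.pos

/-- `K` has a cyclic decomposition of period `p`, of full `π`-measure. -/
def IsCyclicDecomposition (K : Kernel X X) (π : Measure X) (p : ℕ) (C : Fin p → Set X) : Prop :=
  (∀ i, MeasurableSet (C i)) ∧ Pairwise (Function.onFun Disjoint C) ∧
    π (⋃ i, C i) = 1 ∧
      ∀ i : Fin p, ∀ x ∈ C i, K x (C ⟨(i.val + 1) % p, i.val_add_one_mod_lt⟩) = 1

theorem exists_isCyclicDecomposition_of_ae (hK : K.Invariant π) {p : ℕ} (hp : 2 ≤ p) {C : ℤ → Set X}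
    (hC : ∀ m, MeasurableSet (C m)) (hd : ∀ m n y, y ∈ C m → y ∈ C n → (p : ℤ) ∣ m - n)
    (hU : ∀ᵐ x ∂π, ∃ m, x ∈ C m)
    (hs : ∀ᵐ x ∂π, ∀ᵐ y ∂K x, ∀ m, x ∈ C m → y ∈ C (m + 1)) :
    ∃ D, IsCyclicDecomposition K π p D := by
  let E : ZMod p → Set X := fun i => ⋃ m : ℤ, ⋃ _ : (m : ZMod p) = i, C m
  have hEmem : ∀ i x, x ∈ E i ↔ ∃ m : ℤ, (m : ZMod p) = i ∧ x ∈ C m := by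
    intro i x
    simp [E]
  have hE : ∀ i, MeasurableSet (E i) := fun i => .iUnion fun m => .iUnion fun _ => hC m
  have hEU : ∀ i j x, x ∈ E i → x ∈ E j → i = j := by
    intro i j x hi hj
    obtain ⟨m, rfl, hm⟩ := (hEmem _ _).1 hi
    obtain ⟨n, rfl, hn⟩ := (hEmem _ _).1 hj
    have := (ZMod.intCast_zmod_eq_zero_iff_dvd _ p).2 (hd m n x hm hn)
    rw [Int.cast_sub] at this
    exact sub_eq_zero.1 this
  have : NeZero p := ⟨by omega⟩
  let S : Set X := ⋃ i, (E i ∩ {x | K x (E (i + 1))ᶜ = 0})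
  have hS : MeasurableSet S := .iUnion fun i =>
    (hE i).inter (K.measurable_coe (hE _).compl (measurableSet_singleton 0))
  have hSπ : ∀ᵐ x ∂π, x ∈ S := by
    filter_upwards [hU, hs] with x ⟨m, hm⟩ hx
    refine Set.mem_iUnion.2 ⟨m, (hEmem _ _).2 ⟨m, rfl, hm⟩, ?_⟩
    change ∀ᵐ y ∂K x, y ∈ E (m + 1)
    filter_upwards [hx] with y hy
    exact (hEmem _ _).2 ⟨m + 1, by push_cast; rfl, hy m hm⟩
  obtain ⟨G, hGS, hG, hGπ, hGK⟩ := exists_absorbing_subset hK hS hSπ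
  refine ⟨fun i => E (i : ℕ) ∩ G, fun i => (hE _).inter hG, ?_, ?_, ?_⟩
  · intro i j hij
    refine Set.disjoint_left.2 fun x hx hx' => hij ?_
    have := hEU _ _ x hx.1 hx'.1
    rw [ZMod.natCast_eq_natCast_iff, Nat.ModEq, Nat.mod_eq_of_lt i.2, Nat.mod_eq_of_lt j.2] at this
    exact Fin.ext this
  · rw [← prob_compl_eq_zero_iff (.iUnion fun i => (hE _).inter hG), ← mem_ae_iff]
    filter_upwards [hGπ] with x hx
    obtain ⟨i, hi, -⟩ := Set.mem_iUnion.1 (hGS hx)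
    refine Set.mem_iUnion.2 ⟨⟨i.val, i.val_lt⟩, ?_, hx⟩
    simpa using hi
  · rintro i x ⟨hxi, hxG⟩
    obtain ⟨j, hj, hj'⟩ := Set.mem_iUnion.1 (hGS hxG)
    obtain rfl := hEU _ _ x hxi hj
    rw [← prob_compl_eq_zero_iff ((hE _).inter hG), ← mem_ae_iff]
    have hj' : ∀ᵐ y ∂K x, y ∈ E (((i : ℕ) : ZMod p) + 1) := hj'
    filter_upwards [hj', hGK x hxG] with y hy hyG
    refine ⟨?_, hyG⟩
    simpa using hy

theorem exists_ae_tendsto_sub (hK : K.Invariant π)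
    (hirr : ∀ x : X, ∀ A : Set X, MeasurableSet A → 0 < π A → ∃ r : ℕ, 0 < (K ^ r) x A)
    (haper : ¬ ∃ p, ∃ _ : 2 ≤ p, ∃ C, IsCyclicDecomposition K π p C)
    {u : ℕ → ℤ → X → ℝ} (hu : ∀ N k, Measurable (u N k))
    (h : ∀ m : ℕ, ∀ᵐ x ∂π, ∀ᵐ y ∂(K ^ m) x, (m : ℤ) ∈ asympShift u x y) :
    ∃ x, ∀ᵐ y ∂π, Tendsto (fun N => u N 0 y - u N 0 x) atTop (𝓝 0) := by
  obtain ⟨x, hx⟩ := (ae_all_iff.2 h).exists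
  have hU : ∀ᵐ y ∂π, ∃ m, m ∈ asympShift u x y := by
    have hm : MeasurableSet {y | ¬ ∃ m, m ∈ asympShift u x y} := by
      simp only [Set.ofPred_exists, ← Set.compl_ofPred]
      exact (MeasurableSet.iUnion fun m => measurableSet_mem_asympShift hu x m).compl
    by_contra hcon
    obtain ⟨r, hr⟩ := hirr x _ hm (pos_iff_ne_zero.2 hcon)
    refine hr.ne' ?_
    change ∀ᵐ y ∂(K ^ r) x, ∃ m, m ∈ asympShift u x y
    filter_upwards [hx r] with y hy
    exact ⟨r, hy⟩
  by_cases h1 : (1 : ℤ) ∈ asympPeriod u x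
  · refine ⟨x, ?_⟩
    filter_upwards [hU] with y ⟨m, hm⟩
    have h2 : -m ∈ asympPeriod u x := by
      simpa using (asympPeriod u x).zsmul_mem h1 (-m)
    have := add_mem_asympShift (show -m ∈ asympShift u x x from h2) hm 0
    simpa using this
  · obtain ⟨p, hp, hdvd⟩ := exists_two_le_forall_dvd h1
    refine absurd ⟨p, hp, exists_isCyclicDecomposition_of_ae hK hp
      (C := fun m => {y | m ∈ asympShift u x y}) (measurableSet_mem_asympShift hu x)
      (fun m n y hm hn => hdvd _ (add_mem_asympShift hm (neg_mem_asympShift hn))) hU ?_⟩ haper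
    filter_upwards [h 1] with z hz
    rw [pow_one] at hz
    filter_upwards [hz] with y hy m hm
    exact add_mem_asympShift hm hy

theorem ae_tendsto_zero_of_integral_sq_le {Z : Type*} [MeasurableSpace Z] {μ : Measure Z}
    {f : ℕ → Z → ℝ} (hf : ∀ n, Measurable (f n)) (hi : ∀ n, Integrable (fun z => f n z ^ 2) μ)
    (h : ∀ᶠ n in atTop, ∫ z, f n z ^ 2 ∂μ ≤ (1 / 2) ^ n) :
    ∀ᵐ z ∂μ, Tendsto (fun n => f n z) atTop (𝓝 0) := by
  obtain ⟨n₀, hn₀⟩ := eventually_atTop.1 h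
  have hm : ∀ n, Measurable fun z => ENNReal.ofReal (f (n + n₀) z ^ 2) := fun n =>
    ((hf _).pow_const 2).ennreal_ofReal
  have hfin : ∫⁻ z, ∑' n, ENNReal.ofReal (f (n + n₀) z ^ 2) ∂μ ≠ ∞ := by
    rw [lintegral_tsum fun n => (hm n).aemeasurable]
    refine ne_top_of_le_ne_top
      (((summable_nat_add_iff n₀).2 summable_geometric_two).tsum_ofReal_ne_top)
      (ENNReal.tsum_le_tsum fun n => ?_)
    rw [← ofReal_integral_eq_lintegral_ofReal (hi _) (ae_of_all _ fun z => sq_nonneg _)]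
    exact ENNReal.ofReal_le_ofReal (hn₀ _ (Nat.le_add_left _ _))
  filter_upwards [ae_lt_top (Measurable.tsum hm) hfin] with z hz
  have h0 := ENNReal.tendsto_atTop_zero_of_tsum_ne_top hz.ne
  have h1 : Tendsto (fun n => f (n + n₀) z ^ 2) atTop (𝓝 0) := by
    have := (ENNReal.tendsto_toReal ENNReal.zero_ne_top).comp h0
    simpa [Function.comp_def, ENNReal.toReal_ofReal (sq_nonneg _)] using this
  have h2 := h1.sqrt
  simp only [Real.sqrt_sq_eq_abs, Real.sqrt_zero] at h2
  exact (tendsto_add_atTop_iff_nat n₀).1 ((tendsto_zero_iff_abs_tendsto_zero _).2 h2)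

/-- The variance of a function under a probability measure. -/
noncomputable def meanVar (π : Measure X) (h : X → ℝ) : ℝ :=
  ∫ x, h x ^ 2 ∂π - (∫ x, h x ∂π) ^ 2

theorem meanVar_eq {h : X → ℝ} (hh : UnitBounded h) (c : ℝ) :
    ∫ x, (h x - c) ^ 2 ∂π = meanVar π h + (∫ x, h x ∂π - c) ^ 2 := by
  have e : ∀ y, (h y - c) ^ 2 = h y ^ 2 - 2 * c * h y + c ^ 2 := fun y => by ring
  simp_rw [e]
  rw [integral_add, integral_sub, integral_const_mul, meanVar]
  · simp only [integral_const, probReal_univ, smul_eq_mul]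
    ring
  · exact hh.sq.integrable
  · exact hh.integrable.const_mul _
  · exact hh.sq.integrable.sub (hh.integrable.const_mul _)
  · exact integrable_const _

theorem meanVar_expect_antitone (hK : K.Invariant π) {h : X → ℝ} (hh : UnitBounded h) :
    Antitone fun n => meanVar π (expect K n h) := by
  intro m n hmn
  have := integral_sq_expect_antitone hK hh hmn
  simp only [meanVar, integral_expect hK hh]
  linarith

theorem tendsto_meanVar {v : ℕ → X → ℝ} (hv : ∀ N, UnitBounded (v N)) (x : X)
    (h : ∀ᵐ y ∂π, Tendsto (fun N => v N y - v N x) atTop (𝓝 0)) :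
    Tendsto (fun N => meanVar π (v N)) atTop (𝓝 0) := by
  have h1 : Tendsto (fun N => ∫ y, (v N y - v N x) ^ 2 ∂π) atTop (𝓝 (∫ _, 0 ∂π)) := by
    refine tendsto_integral_of_dominated_convergence (fun _ => 4)
      (fun N => (((hv N).measurable.sub_const _).pow_const 2).aestronglyMeasurable)
      (integrable_const _) (fun N => ae_of_all _ fun y => ?_) ?_
    · rw [Real.norm_of_nonneg (sq_nonneg _)]
      have h1 := abs_le.1 ((hv N).abs_le_one y)
      have h2 := abs_le.1 ((hv N).abs_le_one x)
      nlinarith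
    · filter_upwards [h] with y hy
      simpa using hy.pow 2
  rw [integral_zero] at h1
  refine squeeze_zero (fun N => ?_) (fun N => ?_) h1
  · have := meanVar_eq (π := π) (hv N) (∫ x, v N x ∂π)
    rw [sub_self] at this
    have h0 : 0 ≤ ∫ y, (v N y - ∫ x, v N x ∂π) ^ 2 ∂π := integral_nonneg fun _ => sq_nonneg _
    linarith
  · rw [meanVar_eq (hv N)]
    linarith [sq_nonneg (∫ y, v N y ∂π - v N x)]

/-- Some block of `L` steps, among the first `J`, barely decreases the `L²` norm. -/
theorem exists_slow_block {h : X → ℝ} (hh : UnitBounded h) (L : ℕ) {J : ℕ} (hJ : 0 < J) :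
    ∃ j < J, ∫ x, expect K (j * L) h x ^ 2 ∂π - ∫ x, expect K ((j + 1) * L) h x ^ 2 ∂π
      ≤ 1 / J := by
  by_contra! hcon
  have h1 := Finset.sum_lt_sum_of_nonempty (s := Finset.range J)
    (Finset.nonempty_range_iff.2 hJ.ne') fun j hj => hcon j (Finset.mem_range.1 hj)
  rw [Finset.sum_range_sub' (fun j => ∫ x, expect K (j * L) h x ^ 2 ∂π), Finset.sum_const,
    Finset.card_range, nsmul_eq_mul, mul_one_div_cancel (by positivity)] at h1
  have h2 := integral_sq_le_one (π := π) (hh.expect (K := K) (0 * L))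
  have h3 : 0 ≤ ∫ x, expect K (J * L) h x ^ 2 ∂π := integral_nonneg fun _ => sq_nonneg _
  linarith

theorem ae_mem_asympShift (hK : K.Invariant π) {w : ℕ → X → ℝ} (hw : ∀ N, UnitBounded (w N))
    (hslow : ∀ N, ∫ x, w N x ^ 2 ∂π - ∫ x, expect K (2 * N) (w N) x ^ 2 ∂π ≤ (1 / 2) ^ N) (m : ℕ) :
    ∀ᵐ x ∂π, ∀ᵐ y ∂(K ^ m) x,
      (m : ℤ) ∈ asympShift (fun N k => expect K (N - k).toNat (w N)) x y := by
  refine Measure.ae_ae_of_ae_compProd (p := fun z : X × X =>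
    (m : ℤ) ∈ asympShift (fun N k => expect K (N - k).toNat (w N)) z.1 z.2)
    (ae_all_iff.2 fun k => ?_)
  have hU : ∀ (N : ℕ) (k : ℤ), UnitBounded (expect K (N - k).toNat (w N)) :=
    fun N k => (hw N).expect _
  refine ae_tendsto_zero_of_integral_sq_le (fun N => ?_) (fun N => ?_) ?_
  · exact ((hU N _).measurable.comp measurable_snd).sub ((hU N _).measurable.comp measurable_fst)
  · refine integrable_of_abs_le (C := 4) ?_ fun z => ?_
    · exact (((hU N _).measurable.comp measurable_snd).sub
        ((hU N _).measurable.comp measurable_fst)).pow_const 2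
    · rw [abs_of_nonneg (sq_nonneg _)]
      have h1 := abs_le.1 ((hU N (k + m)).abs_le_one z.2)
      have h2 := abs_le.1 ((hU N k).abs_le_one z.1)
      nlinarith
  · filter_upwards [eventually_ge_atTop (k.natAbs + m)] with N hN
    have e : (N - k).toNat = m + (N - (k + m)).toNat := by omega
    have e' : m + (N - (k + m)).toNat ≤ 2 * N := by omega
    have h1 := integral_sq_expect_antitone hK (hw N) (Nat.zero_le (N - (k + m)).toNat)
    have h2 := integral_sq_expect_antitone hK (hw N) e'
    have h3 := integral_sq_sub_expect hK (hU N (k + m)) m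
    simp only [expect_zero (hw N)] at h1
    rw [← expect_add (hw N), ← e] at h3
    rw [← e] at h2
    linarith [hslow N]

theorem exists_meanVar_lt (hK : K.Invariant π)
    (hirr : ∀ x : X, ∀ A : Set X, MeasurableSet A → 0 < π A → ∃ r : ℕ, 0 < (K ^ r) x A)
    (haper : ¬ ∃ p, ∃ _ : 2 ≤ p, ∃ C, IsCyclicDecomposition K π p C) {ε : ℝ} (hε : 0 < ε) :
    ∃ M, ∀ h, UnitBounded h → ∀ n ≥ M, meanVar π (expect K n h) < ε := by
  suffices ∃ M, ∀ h, UnitBounded h → meanVar π (expect K M h) < ε by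
    obtain ⟨M, hM⟩ := this
    exact ⟨M, fun h hh n hn => (meanVar_expect_antitone hK hh hn).trans_lt (hM h hh)⟩
  by_contra! hcon
  have key : ∀ N : ℕ, ∃ w, UnitBounded w ∧ ε ≤ meanVar π (expect K N w) ∧
      ∫ x, w x ^ 2 ∂π - ∫ x, expect K (2 * N) w x ^ 2 ∂π ≤ (1 / 2) ^ N := by
    intro N
    obtain ⟨h, hh, hεh⟩ := hcon (2 ^ N * (2 * N))
    obtain ⟨j, hj, hjs⟩ := exists_slow_block (K := K) (π := π) hh (2 * N)
      (J := 2 ^ N) (by positivity)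
    refine ⟨expect K (j * (2 * N)) h, hh.expect _, ?_, ?_⟩
    · rw [← expect_add hh]
      refine hεh.trans (meanVar_expect_antitone hK hh ?_)
      have := Nat.mul_le_mul_right (2 * N) (Nat.succ_le_of_lt hj)
      rw [Nat.succ_mul] at this
      omega
    · rw [← expect_add hh, add_comm, ← Nat.succ_mul]
      simpa using hjs
  choose w hw hεw hslow using key
  obtain ⟨x, hx⟩ := exists_ae_tendsto_sub hK hirr haper
    (fun N k => ((hw N).expect (N - k).toNat).measurable) (ae_mem_asympShift hK hw hslow)
  simp only [sub_zero, Int.toNat_natCast] at hx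
  exact absurd (ge_of_tendsto' (tendsto_meanVar (fun N => (hw N).expect N) x hx) hεw) hε.not_ge

theorem integral_abs_le_add_measureReal {μ : Measure X} [IsProbabilityMeasure μ] {g : X → ℝ}
    (hg : UnitBounded g) {η : ℝ} (hη : 0 ≤ η) :
    ∫ y, |g y| ∂μ ≤ η + μ.real {y | η ≤ |g y|} := by
  have hm : MeasurableSet {y | η ≤ |g y|} := measurableSet_le measurable_const hg.measurable.abs
  have h : ∫ y, |g y| ∂μ ≤ ∫ y, (η + Set.indicator {y | η ≤ |g y|} 1 y) ∂μ := by
    refine integral_mono hg.integrable.abs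
      ((integrable_const _).add ((integrable_const 1).indicator hm)) fun y => ?_
    by_cases hy : η ≤ |g y|
    · simpa [Set.indicator, hy] using (hg.abs_le_one y).trans (by linarith)
    · simpa [Set.indicator, hy] using (not_le.1 hy).le
  rw [integral_add (integrable_const _) ((integrable_const 1).indicator hm)] at h
  simpa [integral_indicator_one hm] using h

/-- The density of the part of `(K ^ n) x` that is absolutely continuous with respect to `π`. -/
noncomputable def powDensity [StandardBorelSpace X] (K : Kernel X X) (π : Measure X) (n : ℕ)
    (x y : X) : ℝ≥0∞ :=
  Kernel.rnDeriv (K ^ n) (Kernel.const X π) x y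

/-- The part of `K ^ n` that is singular with respect to `π`. -/
noncomputable def powSingular [StandardBorelSpace X] (K : Kernel X X) [IsMarkovKernel K]
    (π : Measure X) [IsProbabilityMeasure π] (n : ℕ) : Kernel X X :=
  Kernel.singularPart (K ^ n) (Kernel.const X π)

/-- The mass of the singular part of `(K ^ n) x`. -/
noncomputable def singularMass [StandardBorelSpace X] (K : Kernel X X) [IsMarkovKernel K]
    (π : Measure X) [IsProbabilityMeasure π] (n : ℕ) (x : X) : ℝ≥0∞ :=
  powSingular K π n x Set.univ

section Singular

variable [StandardBorelSpace X]

theorem withDensity_powDensity_add_powSingular (n : ℕ) (x : X) :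
    π.withDensity (powDensity K π n x) + powSingular K π n x = (K ^ n) x := by
  conv_rhs => rw [← Kernel.rnDeriv_add_singularPart (K ^ n) (Kernel.const X π)]
  rw [FunLike.coe_add, Pi.add_apply, Kernel.withDensity_apply _ (Kernel.measurable_rnDeriv _ _)]
  rfl

theorem measurable_powDensity {K : Kernel X X} {π : Measure X} (n : ℕ) :
    Measurable fun z : X × X => powDensity K π n z.1 z.2 :=
  Kernel.measurable_rnDeriv _ _

theorem measurable_singularMass (n : ℕ) : Measurable (singularMass K π n) :=
  Kernel.measurable_coe _ .univ

theorem exists_null_powSingular_compl (n : ℕ) (x : X) :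
    ∃ E, MeasurableSet E ∧ π E = 0 ∧ powSingular K π n x Eᶜ = 0 := by
  obtain ⟨E, hE, h1, h2⟩ :=
    Kernel.mutuallySingular_singularPart (K ^ n) (Kernel.const X π) x
  exact ⟨Eᶜ, hE.compl, h2, by rwa [compl_compl]⟩

theorem powSingular_le (n : ℕ) (x : X) : powSingular K π n x ≤ (K ^ n) x := by
  conv_rhs => rw [← withDensity_powDensity_add_powSingular (π := π)]
  exact Measure.le_add_left le_rfl

theorem singularMass_le_one (n : ℕ) (x : X) : singularMass K π n x ≤ 1 :=
  (powSingular_le n x _).trans prob_le_one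

theorem singularMass_add_le (hK : K.Invariant π) (m n : ℕ) (x : X) :
    singularMass K π (m + n) x ≤ ∫⁻ y, singularMass K π m y ∂powSingular K π n x := by
  obtain ⟨E, hE, hπE, hsE⟩ := exists_null_powSingular_compl (K := K) (π := π) (m + n) x
  have hKE : ∀ᵐ y ∂π, (K ^ m) y E = 0 := by
    have : ((K ^ m) ∘ₘ π) E = 0 := by rwa [(invariant_pow hK m).def]
    rw [Measure.bind_apply hE (Kernel.aemeasurable _),
      lintegral_eq_zero_iff ((K ^ m).measurable_coe hE)] at this
    exact this
  calc singularMass K π (m + n) x = powSingular K π (m + n) x E := by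
        rw [singularMass, ← measure_add_measure_compl hE, hsE, add_zero]
    _ ≤ (K ^ (m + n)) x E := powSingular_le _ _ _
    _ = ∫⁻ y, (K ^ m) y E ∂(K ^ n) x := by rw [Kernel.pow_add, Kernel.comp_apply' _ _ _ hE]
    _ = ∫⁻ y, (K ^ m) y E ∂powSingular K π n x := by
        rw [← withDensity_powDensity_add_powSingular (π := π), lintegral_add_measure,
          lintegral_congr_ae ((withDensity_absolutelyContinuous _ _).ae_le hKE), lintegral_zero,
          zero_add]
    _ ≤ ∫⁻ y, singularMass K π m y ∂powSingular K π n x := by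
        refine lintegral_mono fun y => ?_
        rw [← withDensity_powDensity_add_powSingular (π := π), Measure.add_apply,
          withDensity_absolutelyContinuous _ _ hπE, zero_add]
        exact measure_mono (Set.subset_univ E)

theorem lintegral_powDensity_mul_add_le (hK : K.Invariant π) (m n : ℕ) :
    ∫⁻ x, ∫⁻ y, powDensity K π n x y * singularMass K π m y ∂π ∂π +
      ∫⁻ x, singularMass K π (m + n) x ∂π ≤ ∫⁻ x, singularMass K π m x ∂π := by
  have hm := measurable_singularMass (K := K) (π := π) m
  have hp : ∀ x, Measurable (powDensity K π n x) := fun x =>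
    (measurable_powDensity n).comp measurable_prodMk_left
  calc _ = ∫⁻ x, (∫⁻ y, powDensity K π n x y * singularMass K π m y ∂π +
        singularMass K π (m + n) x) ∂π :=
        (lintegral_add_right _ (measurable_singularMass _)).symm
    _ ≤ ∫⁻ x, ∫⁻ y, singularMass K π m y ∂(K ^ n) x ∂π := by
        refine lintegral_mono fun x => ?_
        rw [← withDensity_powDensity_add_powSingular (π := π), lintegral_add_measure,
          lintegral_withDensity_eq_lintegral_mul _ (hp x) hm]
        gcongr
        · rfl
        · exact singularMass_add_le hK m n x
    _ = ∫⁻ x, singularMass K π m x ∂π := by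
        rw [← Measure.lintegral_bind (Kernel.aemeasurable _) hm.aemeasurable,
          (invariant_pow hK n).def]

theorem antitone_lintegral_singularMass (hK : K.Invariant π) :
    Antitone fun m => ∫⁻ x, singularMass K π m x ∂π :=
  antitone_nat_of_succ_le fun m =>
    le_add_self.trans (lintegral_powDensity_mul_add_le hK m 1)

theorem lintegral_powDensity_mul_iInf (hK : K.Invariant π) (n : ℕ) :
    ∫⁻ x, ∫⁻ y, powDensity K π n x y * ⨅ m, singularMass K π m y ∂π ∂π = 0 := by
  have h1 : Tendsto (fun m => ∫⁻ x, singularMass K π m x ∂π) atTop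
      (𝓝 (⨅ m, ∫⁻ x, singularMass K π m x ∂π)) :=
    tendsto_atTop_iInf (antitone_lintegral_singularMass hK)
  have hle : ∀ m, ∫⁻ x, singularMass K π m x ∂π ≤ 1 := fun m => by
    simpa using lintegral_mono (μ := π) fun x => singularMass_le_one (K := K) (π := π) m x
  have h2 := le_of_tendsto_of_tendsto'
    (((tendsto_add_atTop_iff_nat n).2 h1).const_add
      (∫⁻ x, ∫⁻ y, powDensity K π n x y * ⨅ m, singularMass K π m y ∂π ∂π)) h1 fun m => by
    refine le_trans ?_ (lintegral_powDensity_mul_add_le hK m n)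
    gcongr
    exact iInf_le _ m
  refine le_antisymm ?_ zero_le
  have hne : ⨅ m, ∫⁻ x, singularMass K π m x ∂π ≠ ∞ :=
    ne_top_of_le_ne_top ENNReal.one_ne_top ((iInf_le _ 0).trans (hle 0))
  exact (ENNReal.add_le_add_iff_right hne).1 (by rwa [zero_add])

theorem ae_exists_powDensity_ne_zero
    (hirr : ∀ x : X, ∀ A : Set X, MeasurableSet A → 0 < π A → ∃ r : ℕ, 0 < (K ^ r) x A) (x : X) :
    ∀ᵐ y ∂π, ∃ n, powDensity K π n x y ≠ 0 := by
  choose E hE hπE hsE using fun n => exists_null_powSingular_compl (K := K) (π := π) n x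
  have hp : ∀ n, Measurable (powDensity K π n x) := fun n =>
    (measurable_powDensity n).comp measurable_prodMk_left
  let A : Set X := ⋂ n, (powDensity K π n x ⁻¹' {0} ∩ (E n)ᶜ)
  have hA : MeasurableSet A := .iInter fun n =>
    (hp n (measurableSet_singleton 0)).inter (hE n).compl
  have hA0 : π A = 0 := by
    by_contra hcon
    obtain ⟨r, hr⟩ := hirr x A hA (pos_iff_ne_zero.2 hcon)
    refine hr.ne' ?_
    rw [← withDensity_powDensity_add_powSingular (π := π), Measure.add_apply, add_eq_zero]
    constructor
    · rw [withDensity_apply _ hA]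
      exact setLIntegral_eq_zero hA fun y hy => (Set.mem_iInter.1 hy r).1
    · exact measure_mono_null (fun y hy => (Set.mem_iInter.1 hy r).2) (hsE r)
  filter_upwards [measure_eq_zero_iff_ae_notMem.1 hA0,
    ae_all_iff.2 fun n => measure_eq_zero_iff_ae_notMem.1 (hπE n)] with y hy hyE
  by_contra! hcon
  exact hy (Set.mem_iInter.2 fun n => ⟨hcon n, hyE n⟩)

theorem ae_iInf_singularMass_eq_zero (hK : K.Invariant π)
    (hirr : ∀ x : X, ∀ A : Set X, MeasurableSet A → 0 < π A → ∃ r : ℕ, 0 < (K ^ r) x A) :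
    ∀ᵐ y ∂π, ⨅ m, singularMass K π m y = 0 := by
  have hs : Measurable fun y => ⨅ m, singularMass K π m y := .iInf measurable_singularMass
  have h : ∀ n, ∀ᵐ x ∂π, ∀ᵐ y ∂π, powDensity K π n x y * ⨅ m, singularMass K π m y = 0 := by
    intro n
    have hm : Measurable fun z : X × X => powDensity K π n z.1 z.2 * ⨅ m, singularMass K π m z.2 :=
      (measurable_powDensity n).mul (hs.comp measurable_snd)
    have h0 := (lintegral_eq_zero_iff hm.lintegral_prod_right').1
      (lintegral_powDensity_mul_iInf hK n)
    filter_upwards [h0] with x hx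
    exact (lintegral_eq_zero_iff (hm.comp measurable_prodMk_left)).1 hx
  obtain ⟨x, hx⟩ := (ae_all_iff.2 h).exists
  filter_upwards [ae_all_iff.2 hx, ae_exists_powDensity_ne_zero hirr x] with y hy ⟨n, hn⟩
  exact (mul_eq_zero.1 (hy n)).resolve_left hn

theorem lintegral_powDensity_ne_top (n : ℕ) (x : X) : ∫⁻ y, powDensity K π n x y ∂π ≠ ∞ := by
  refine ne_top_of_le_ne_top (measure_ne_top ((K ^ n) x) Set.univ) ?_
  rw [← withDensity_powDensity_add_powSingular (π := π), Measure.add_apply,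
    withDensity_apply _ .univ, Measure.restrict_univ]
  exact le_self_add

theorem tendsto_tvDist_pow (hK : K.Invariant π)
    (hvar : ∀ ε > 0, ∃ M, ∀ h, UnitBounded h → ∀ n ≥ M, meanVar π (expect K n h) < ε) {x : X}
    (hx : ⨅ m, singularMass K π m x = 0) :
    Tendsto (fun n => tvDist ((K ^ n) x) π) atTop (𝓝 0) := by
  rw [Metric.tendsto_atTop]
  intro ε hε
  set η := ε / 4 with hη
  have hη0 : 0 < η := by positivity
  obtain ⟨m, hm⟩ : ∃ m, singularMass K π m x < ENNReal.ofReal η :=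
    iInf_lt_iff.1 (by rw [hx]; exact ENNReal.ofReal_pos.2 hη0)
  obtain ⟨δ, hδ0, hδ⟩ := exists_pos_setLIntegral_lt_of_measure_lt
    (lintegral_powDensity_ne_top (K := K) (π := π) m x) (ENNReal.ofReal_pos.2 hη0).ne'
  obtain ⟨δ', hδ'0, hδ'⟩ := ENNReal.lt_iff_exists_real_btwn.1 hδ0
  have hδ'0 : 0 < δ' := ENNReal.ofReal_pos.1 hδ'.1
  obtain ⟨M, hM⟩ := hvar (η ^ 2 * δ') (by positivity)
  refine ⟨m + M, fun n hn => ?_⟩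
  have hbound : ∀ A : Set X, MeasurableSet A →
      |((K ^ n) x A).toReal - (π A).toReal| ≤ 3 * η := by
    intro A hA
    obtain ⟨k, rfl⟩ := Nat.exists_eq_add_of_le hn
    have h1A : UnitBounded (Set.indicator A (1 : X → ℝ)) :=
      ⟨measurable_one.indicator hA, fun y => by by_cases hy : y ∈ A <;> simp [hy]⟩
    set f := expect K (M + k) (Set.indicator A (1 : X → ℝ)) with hf
    have hfU : UnitBounded f := h1A.expect _
    have hf01 : ∀ y, 0 ≤ f y ∧ f y ≤ 1 := fun y =>
      ⟨integral_nonneg fun z => Set.indicator_nonneg (fun _ _ => zero_le_one) z,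
        (abs_le.1 (hfU.abs_le_one y)).2⟩
    have hπf : ∫ y, f y ∂π = π.real A := by
      rw [hf, integral_expect hK h1A, integral_indicator_one hA]
    have hg : UnitBounded fun y => f y - π.real A := by
      refine ⟨hfU.measurable.sub_const _, fun y => abs_le.2 ⟨?_, ?_⟩⟩
      · linarith [(hf01 y).1, measureReal_le_one (μ := π) (s := A)]
      · linarith [(hf01 y).2, measureReal_nonneg (μ := π) (s := A)]
    have hKA : ((K ^ (m + M + k)) x A).toReal = ∫ y, f y ∂(K ^ m) x := by
      have := congrFun (expect_add (K := K) h1A m (M + k)) x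
      rw [← add_assoc, expect, integral_indicator_one hA] at this
      exact this
    have hsmall : π {y | η ≤ |f y - π.real A|} < δ := by
      refine lt_of_le_of_lt ?_ hδ'.2
      have h1 := mul_meas_ge_le_integral_of_nonneg (μ := π) (f := fun y => (f y - π.real A) ^ 2)
        (ae_of_all _ fun y => sq_nonneg _) hg.sq.integrable (η ^ 2)
      have h2 := meanVar_eq (π := π) hfU (π.real A)
      rw [hπf, sub_self] at h2
      have h3 := hM _ h1A (M + k) (Nat.le_add_right _ _)
      have h4 : {y | η ^ 2 ≤ (f y - π.real A) ^ 2} = {y | η ≤ |f y - π.real A|} := by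
        ext y
        simp only [Set.mem_ofPred_eq]
        rw [← sq_abs (f y - _), sq_le_sq₀ hη0.le (abs_nonneg _)]
      rw [h4] at h1
      refine ENNReal.le_ofReal_iff_toReal_le (measure_ne_top _ _) hδ'0.le |>.2 ?_
      refine le_of_mul_le_mul_left (?_ : η ^ 2 * _ ≤ η ^ 2 * δ') (by positivity)
      exact h1.trans (by linarith)
    have hmeas : MeasurableSet {y | η ≤ |f y - π.real A|} :=
      measurableSet_le measurable_const hg.measurable.abs
    have hmass : ((K ^ m) x).real {y | η ≤ |f y - π.real A|} ≤ 2 * η := by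
      refine ENNReal.toReal_le_of_le_ofReal (by positivity) ?_
      rw [← withDensity_powDensity_add_powSingular (π := π), Measure.add_apply,
        withDensity_apply _ hmeas, two_mul, ENNReal.ofReal_add hη0.le hη0.le]
      exact add_le_add (hδ _ hsmall).le ((measure_mono (Set.subset_univ _)).trans hm.le)
    calc |((K ^ (m + M + k)) x A).toReal - (π A).toReal|
        = |∫ y, (f y - π.real A) ∂(K ^ m) x| := by
          rw [hKA, integral_sub hfU.integrable (integrable_const _)]
          simp [Measure.real]
      _ ≤ ∫ y, |f y - π.real A| ∂(K ^ m) x := abs_integral_le_integral_abs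
      _ ≤ η + ((K ^ m) x).real {y | η ≤ |f y - π.real A|} :=
          integral_abs_le_add_measureReal hg hη0.le
      _ ≤ 3 * η := by linarith
  have h0 : 0 ≤ tvDist ((K ^ n) x) π := Real.iSup_nonneg fun A => abs_nonneg _
  rw [Real.dist_eq, sub_zero, abs_of_nonneg h0]
  have : Nonempty { A : Set X // MeasurableSet A } := ⟨⟨∅, .empty⟩⟩
  have h3 : tvDist ((K ^ n) x) π ≤ 3 * η := ciSup_le fun A => hbound A.1 A.2
  linarith

end Singular

end Markov

/-- if a Markov kernel `K` on a standard Borel space leaves a probability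
measure `π` invariant, is `π`-irreducible and aperiodic (no cyclic decomposition of
order `≥ 2`), then for `π`-almost every starting point `x` the iterates `K^r(x, ·)`
converge to `π` in total variation norm as `r → ∞`. -/
theorem markov_kernel_tv_convergence
    {X : Type*} [MeasurableSpace X] [StandardBorelSpace X]
    (K : Kernel X X) [IsMarkovKernel K]
    (π : Measure X) [IsProbabilityMeasure π]
    -- invariance: π K = π
    (hinv : π.bind (fun x => K x) = π)
    -- π-irreducibility
    (hirr : ∀ x : X, ∀ A : Set X, MeasurableSet A → 0 < π A →
      ∃ r : ℕ, 1 ≤ r ∧ 0 < (kiter K r) x A)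
    -- aperiodicity: no cyclic decomposition of period d ≥ 2
    (haper : ¬ ∃ p : ℕ, ∃ hp : 2 ≤ p, ∃ C : Fin p → Set X,
      (∀ i, MeasurableSet (C i)) ∧ Pairwise (Function.onFun Disjoint C) ∧
        π (⋃ i, C i) = 1 ∧
          ∀ i : Fin p, ∀ x ∈ C i, K x (C ⟨(↑i + 1) % p, Nat.mod_lt _ (by omega)⟩) = 1) :
    ∀ᵐ x ∂π, Tendsto (fun r => tvDist ((kiter K r) x) π) atTop (nhds 0) := by
  have hirr' : ∀ x : X, ∀ A : Set X, MeasurableSet A → 0 < π A → ∃ r : ℕ, 0 < (K ^ r) x A := by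
    intro x A hA hπA
    obtain ⟨r, -, hr⟩ := hirr x A hA hπA
    exact ⟨r, by rwa [kiter_eq_pow] at hr⟩
  filter_upwards [ae_iInf_singularMass_eq_zero hinv hirr'] with x hx
  simp only [kiter_eq_pow]
  exact tendsto_tvDist_pow hinv (fun ε hε => exists_meanVar_lt hinv hirr' haper hε) hx
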